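/- arXiv:1907.11147 — 2 statements merged into one kernel-verified Lean document; each statement's English description precedes it below -/
import Mathlib

section
/- Let α > 0 satisfy tan(α) = −coth(α), and define u : ℝ² → ℝ by u(x,y) = cos(αx)·sinh(αy). Then u is harmonic on ℝ², and u satisfies the Steklov boundary condition with eigenvalue λ = α·coth(α) on the whole boundary of the square Q: for all y ∈ [−1,1], ∂₁u(1,y) = λ·u(1,y) and −∂₁u(−1,y) = λ·u(−1,y), and for all x ∈ [−1,1], ∂₂u(x,1) = λ·u(x,1) and −∂₂u(x,−1) = λ·u(x,−1). -/
/-- Partial derivative of `u : ℝ × ℝ → ℝ` with respect to the first coordinate. -/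
noncomputable def pd1 (u : ℝ × ℝ → ℝ) (p : ℝ × ℝ) : ℝ := deriv (fun x => u (x, p.2)) p.1

/-- Partial derivative of `u : ℝ × ℝ → ℝ` with respect to the second coordinate. -/
noncomputable def pd2 (u : ℝ × ℝ → ℝ) (p : ℝ × ℝ) : ℝ := deriv (fun y => u (p.1, y)) p.2

/-- `u` is harmonic on all of `ℝ²`: twice continuously differentiable with
`∂²u/∂x₁² + ∂²u/∂x₂² = 0` everywhere. -/
def Harmonic2 (u : ℝ × ℝ → ℝ) : Prop :=
  ContDiff ℝ 2 u ∧ ∀ p : ℝ × ℝ, pd1 (pd1 u) p + pd2 (pd2 u) p = 0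

theorem pd1_mul {f f' g : ℝ → ℝ} (hf : ∀ x, HasDerivAt f (f' x) x) :
    pd1 (fun p => f p.1 * g p.2) = fun p => f' p.1 * g p.2 :=
  funext fun p => ((hf p.1).mul_const (g p.2)).deriv

theorem pd2_mul {f g g' : ℝ → ℝ} (hg : ∀ y, HasDerivAt g (g' y) y) :
    pd2 (fun p => f p.1 * g p.2) = fun p => f p.1 * g' p.2 :=
  funext fun p => ((hg p.2).const_mul (f p.1)).deriv

theorem hasDerivAt_comp_mul_left {f f' : ℝ → ℝ} (hf : ∀ x, HasDerivAt f (f' x) x) (a x : ℝ) :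
    HasDerivAt (fun x => f (a * x)) (a * f' (a * x)) x := by
  simpa [mul_comm, Function.comp_def] using (hf (a * x)).comp x ((hasDerivAt_id x).const_mul a)

/-- If `tan α = -coth α` with `α > 0`, then `u(x,y) = cos(αx)·sinh(αy)` is harmonic on `ℝ²`
and satisfies the Steklov boundary condition with eigenvalue `λ = α·coth α` on the whole
boundary of the square `(-1,1) × (-1,1)`. -/
theorem steklov_square_cos_sinh (α : ℝ) (hα : 0 < α)
    (htan : Real.tan α = -(Real.cosh α / Real.sinh α))
    (u : ℝ × ℝ → ℝ) (hu : u = fun p => Real.cos (α * p.1) * Real.sinh (α * p.2))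
    (lam : ℝ) (hlam : lam = α * (Real.cosh α / Real.sinh α)) :
    Harmonic2 u ∧
      (∀ y ∈ Set.Icc (-1 : ℝ) 1,
        pd1 u (1, y) = lam * u (1, y) ∧ -pd1 u (-1, y) = lam * u (-1, y)) ∧
      (∀ x ∈ Set.Icc (-1 : ℝ) 1,
        pd2 u (x, 1) = lam * u (x, 1) ∧ -pd2 u (x, -1) = lam * u (x, -1)) := by
  subst hu hlam
  have hsinh : Real.sinh α ≠ 0 := (Real.sinh_pos_iff.mpr hα).ne'
  have hcos : Real.cos α ≠ 0 := by
    intro h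
    rw [Real.tan_eq_sin_div_cos, h, div_zero, eq_comm, neg_eq_zero] at htan
    exact (div_pos (Real.cosh_pos α) (Real.sinh_pos_iff.mpr hα)).ne' htan
  have hsin : Real.sin α = -(Real.cosh α / Real.sinh α) * Real.cos α := by
    rw [← htan, Real.tan_mul_cos hcos]
  have dcos := hasDerivAt_comp_mul_left Real.hasDerivAt_cos α
  have dsin := hasDerivAt_comp_mul_left Real.hasDerivAt_sin α
  have dsinh := hasDerivAt_comp_mul_left Real.hasDerivAt_sinh α
  have dcosh := hasDerivAt_comp_mul_left Real.hasDerivAt_cosh α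
  have h1 := pd1_mul (g := fun y => Real.sinh (α * y)) dcos
  have h2 := pd2_mul (f := fun x => Real.cos (α * x)) dsinh
  refine ⟨⟨by fun_prop, fun p => ?_⟩, fun y _ => ?_, fun x _ => ?_⟩
  · have h11 := pd1_mul (g := fun y => Real.sinh (α * y)) fun x => (dsin x).neg.const_mul α
    have h22 := pd2_mul (f := fun x => Real.cos (α * x)) fun y => (dcosh y).const_mul α
    simp only [Pi.neg_apply] at h11
    rw [h1, h2, h11, h22]
    ring
  · simp only [h1, mul_one, mul_neg, Real.sin_neg, Real.cos_neg, hsin]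
    constructor <;> ring
  · simp only [h2, mul_one, mul_neg, Real.sinh_neg, Real.cosh_neg]
    constructor <;> field_simp
end

section
/- Let Γ_S ⊆ S¹ be a Borel measurable subset of the unit circle, let λ ∈ ℝ, and let x, y ∈ D with x ≠ y. Suppose R_x, R_y : ℝ² → ℝ are continuously differentiable on an open neighborhood of the closed unit disk and harmonic on D, and define S_x(z) = (1/(2π))·log‖x − z‖ + R_x(z) and S_y(z) = (1/(2π))·log‖y − z‖ + R_y(z). Assume both satisfy the same Steklov-Neumann boundary conditions: p · ∇S_x(p) = λ · S_x(p) and p · ∇S_y(p) = λ · S_y(p) for all p ∈ Γ_S, while p · ∇S_x(p) = 0 and p · ∇S_y(p) = 0 for all p ∈ S¹ \ Γ_S. Then S_x(y) = S_y(x); i.e. the Steklov-Neumann Green's function is symmetric in its two arguments. -/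
open MeasureTheory Metric

/-- The Laplacian `∂²u/∂x₁² + ∂²u/∂x₂²` of `u : ℝ² → ℝ` at a point `p`. -/
noncomputable def laplacian2 (u : EuclideanSpace ℝ (Fin 2) → ℝ)
    (p : EuclideanSpace ℝ (Fin 2)) : ℝ :=
  ∑ i : Fin 2,
    fderiv ℝ (fun x => fderiv ℝ u x (EuclideanSpace.single i (1 : ℝ))) p
      (EuclideanSpace.single i (1 : ℝ))

/-- `u` is harmonic on an open set `U ⊆ ℝ²`: it is twice continuously differentiable
on `U` and its Laplacian vanishes at every point of `U`. -/
def IsHarmonicOn (u : EuclideanSpace ℝ (Fin 2) → ℝ)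
    (U : Set (EuclideanSpace ℝ (Fin 2))) : Prop :=
  ContDiffOn ℝ 2 u U ∧ ∀ p ∈ U, laplacian2 u p = 0

open Complex in
theorem hasFDerivAt_log_norm {f : ℂ → ℂ} {f' z : ℂ} (hf : HasDerivAt f f' z) (h0 : f z ≠ 0) :
    ∃ L : ℂ →L[ℝ] ℝ, HasFDerivAt (fun w => Real.log ‖f w‖) L z ∧
      ∀ w, L w = (f' * w / f z).re := by
  have h1 := (hf.hasFDerivAt.restrictScalars ℝ).norm_sq
  have hpos : ‖f z‖ ^ 2 ≠ 0 := by positivity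
  have h2 := (h1.log hpos).const_mul (1 / 2 : ℝ)
  refine ⟨_, h2.congr_of_eventuallyEq (Filter.Eventually.of_forall fun w => ?_), fun w => ?_⟩
  · simp [Real.log_pow]
  · rw [div_re, ← normSq_eq_norm_sq]
    rw [← normSq_eq_norm_sq] at hpos
    simp [Complex.inner]
    field_simp
    ring

open Complex in
theorem fderiv_re_apply_self {F : ℂ → ℂ} {u : ℂ → ℝ} {z : ℂ} (hF : DifferentiableAt ℂ F z)
    (hu : (fun w => (F w).re) =ᶠ[nhds z] u) : fderiv ℝ u z z = (z * deriv F z).re := by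
  have h := (reCLM.hasFDerivAt (x := F z)).comp z (hF.hasDerivAt.hasFDerivAt.restrictScalars ℝ)
  rw [(h.congr_of_eventuallyEq hu.symm).fderiv]
  simp

open Complex in
/-- Green's second identity on circles for real parts of holomorphic functions. -/
theorem circleAverage_re_mul_re_sub {F G : ℂ → ℂ} {R r : ℝ}
    (hF : AnalyticOnNhd ℂ F (ball 0 R)) (hG : AnalyticOnNhd ℂ G (ball 0 R))
    (hr : 0 < r) (hrR : r < R) :
    Real.circleAverage (fun z => (F z).re * (z * deriv G z).re - (G z).re * (z * deriv F z).re)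
      0 r = 0 := by
  have hmem : ∀ θ, circleMap 0 r θ ∈ ball (0 : ℂ) R := fun θ => by
    simpa [abs_of_pos hr] using hrR
  have hsub : closedBall (0 : ℂ) r ⊆ ball 0 R := closedBall_subset_ball hrR
  have hK : AnalyticOnNhd ℂ (fun z => F z * (z * deriv G z)) (ball 0 R) :=
    hF.mul (analyticOnNhd_id.mul hG.deriv)
  have hKavg : Real.circleAverage (fun z => F z * (z * deriv G z)) 0 r = 0 := by
    rw [DiffContOnCl.circleAverage]
    · simp
    · rw [abs_of_pos hr]
      refine (hK.differentiableOn.mono ?_).diffContOnCl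
      exact closure_ball_subset_closedBall.trans hsub
  have hcont : ∀ {K : ℂ → ℂ}, AnalyticOnNhd ℂ K (ball 0 R) →
      Continuous fun θ => K (circleMap 0 r θ) := fun {K} hK =>
    hK.continuousOn.comp_continuous (continuous_circleMap 0 r) hmem
  have hd : ∀ {K : ℂ → ℂ}, AnalyticOnNhd ℂ K (ball 0 R) → ∀ θ,
      HasDerivAt (fun θ => K (circleMap 0 r θ))
        (I * (circleMap 0 r θ * deriv K (circleMap 0 r θ))) θ := fun {K} hK θ => by
    have := (hK _ (hmem θ)).differentiableAt.hasDerivAt.comp θ (hasDerivAt_circleMap 0 r θ)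
    refine this.congr_deriv ?_
    ring
  have him : ∀ θ, HasDerivAt (fun θ => (F (circleMap 0 r θ)).im)
      (circleMap 0 r θ * deriv F (circleMap 0 r θ)).re θ := fun θ => by
    exact (imCLM.hasFDerivAt.comp_hasDerivAt θ (hd hF θ)).congr_deriv (by simp)
  have hre : ∀ θ, HasDerivAt (fun θ => (G (circleMap 0 r θ)).re)
      (-(circleMap 0 r θ * deriv G (circleMap 0 r θ)).im) θ := fun θ => by
    exact (reCLM.hasFDerivAt.comp_hasDerivAt θ (hd hG θ)).congr_deriv (by simp)
  have hcF := hcont hF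
  have hcG := hcont hG
  have hcF' : Continuous fun θ => circleMap 0 r θ * deriv F (circleMap 0 r θ) :=
    hcont (analyticOnNhd_id.mul hF.deriv)
  have hcG' : Continuous fun θ => circleMap 0 r θ * deriv G (circleMap 0 r θ) :=
    hcont (analyticOnNhd_id.mul hG.deriv)
  have hc1 : Continuous fun θ => (F (circleMap 0 r θ) *
      (circleMap 0 r θ * deriv G (circleMap 0 r θ))).re :=
    continuous_re.comp (hcF.mul hcG')
  have hc2 : Continuous fun θ => (circleMap 0 r θ * deriv F (circleMap 0 r θ)).re *
      (G (circleMap 0 r θ)).re +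
      (F (circleMap 0 r θ)).im * -(circleMap 0 r θ * deriv G (circleMap 0 r θ)).im :=
    ((continuous_re.comp hcF').mul (continuous_re.comp hcG)).add
      ((continuous_im.comp hcF).mul (continuous_im.comp hcG').neg)
  have hFT := intervalIntegral.integral_eq_sub_of_hasDerivAt (a := 0) (b := 2 * Real.pi)
    (fun θ _ => (him θ).mul (hre θ)) (hc2.intervalIntegrable _ _)
  have hper : circleMap 0 r (2 * Real.pi) = circleMap 0 r 0 := by
    simpa using periodic_circleMap 0 r 0
  simp only [Pi.mul_apply, hper, sub_self] at hFT
  rw [Real.circleAverage_def, smul_eq_zero] at hKavg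
  have hK0 := hKavg.resolve_left (by positivity)
  have hK1 : ∫ θ in (0 : ℝ)..2 * Real.pi, (F (circleMap 0 r θ) *
      (circleMap 0 r θ * deriv G (circleMap 0 r θ))).re = 0 := by
    have := reCLM.intervalIntegral_comp_comm (μ := volume) (a := 0) (b := 2 * Real.pi)
      ((hcF.mul hcG').intervalIntegrable _ _)
    simp only [reCLM_apply, Pi.mul_apply] at this
    rw [this, hK0, zero_re]
  rw [Real.circleAverage_def]
  have := intervalIntegral.integral_sub (μ := volume) (a := 0) (b := 2 * Real.pi)
    (hc1.intervalIntegrable _ _) (hc2.intervalIntegrable _ _)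
  rw [hK1, hFT, sub_zero] at this
  rw [smul_eq_zero]
  right
  rw [← this]
  congr 1
  ext θ
  rw [mul_re (F _)]
  ring

open InnerProductSpace in
/-- Green's second identity on the unit disk for harmonic functions that are `C¹` up to the
boundary. -/
theorem circleAverage_green {u v : ℂ → ℝ} {U : Set ℂ} (hU : IsOpen U)
    (hball : closedBall (0 : ℂ) 1 ⊆ U) (hu : ContDiffOn ℝ 1 u U) (hv : ContDiffOn ℝ 1 v U)
    (hu' : HarmonicOnNhd u (ball 0 1)) (hv' : HarmonicOnNhd v (ball 0 1)) :
    Real.circleAverage (fun z => u z * fderiv ℝ v z z - v z * fderiv ℝ u z z) 0 1 = 0 := by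
  obtain ⟨F, hF, hFu⟩ := hu'.exists_analyticOnNhd_ball_re_eq
  obtain ⟨G, hG, hGv⟩ := hv'.exists_analyticOnNhd_ball_re_eq
  refine Real.ContinuousOn.eq_of_eqOn_Ioo (r := 0) ?_ one_pos ?_
  · refine Real.ContinuousOn.circleAverage ?_ fun r hr => hr.1.le
    have h1 := hu.continuousOn_fderiv_of_isOpen hU le_rfl
    have h2 := hv.continuousOn_fderiv_of_isOpen hU le_rfl
    refine ContinuousOn.mono (s := U) ?_ fun z hz => hball ?_
    · exact (hu.continuousOn.mul (h2.clm_apply continuousOn_id)).sub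
        (hv.continuousOn.mul (h1.clm_apply continuousOn_id))
    · simpa using hz.2
  · intro r hr
    change _ = (0 : ℝ)
    rw [← circleAverage_re_mul_re_sub hF hG hr.1 hr.2]
    refine Real.circleAverage_congr_sphere fun z hz => ?_
    have hz1 : z ∈ ball (0 : ℂ) 1 := by
      rw [abs_of_pos hr.1] at hz
      exact sphere_subset_ball hr.2 hz
    have hn := isOpen_ball.mem_nhds hz1
    rw [fderiv_re_apply_self (hF z hz1).differentiableAt (hFu.eventuallyEq_of_mem hn),
      fderiv_re_apply_self (hG z hz1).differentiableAt (hGv.eventuallyEq_of_mem hn),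
      ← hFu hz1, ← hGv hz1]

theorem one_sub_conj_mul_ne_zero {a z : ℂ} (ha : ‖a‖ < 1) (hz : ‖z‖ ≤ 1) :
    1 - (starRingEnd ℂ) a * z ≠ 0 := by
  intro h
  have h1 : ‖(starRingEnd ℂ) a * z‖ = 1 := by rw [← sub_eq_zero.1 h]; simp
  rw [norm_mul, RCLike.norm_conj] at h1
  nlinarith [norm_nonneg a, norm_nonneg z]

theorem norm_sub_eq_norm_one_sub_conj_mul {a z : ℂ} (hz : ‖z‖ = 1) :
    ‖z - a‖ = ‖1 - (starRingEnd ℂ) a * z‖ := by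
  have h : (starRingEnd ℂ) z * z = 1 := by
    rw [mul_comm, Complex.mul_conj, Complex.normSq_eq_norm_sq, hz]; simp
  have : 1 - (starRingEnd ℂ) a * z = (starRingEnd ℂ) (z - a) * z := by
    rw [map_sub, sub_mul, h]
  rw [this, norm_mul, hz, RCLike.norm_conj, mul_one]

/-- On the unit circle, the Poisson kernel in terms of the reflected logarithmic pole. -/
theorem re_div_sub_eq {a z : ℂ} (ha : ‖a‖ < 1) (hz : ‖z‖ = 1) :
    (z / (z - a)).re = 1 - (-(starRingEnd ℂ) a * z / (1 - (starRingEnd ℂ) a * z)).re := by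
  have h : (starRingEnd ℂ) z * z = 1 := by
    rw [mul_comm, Complex.mul_conj, Complex.normSq_eq_norm_sq, hz]; simp
  have h0 := one_sub_conj_mul_ne_zero ha hz.le
  have h1 : (starRingEnd ℂ) z - (starRingEnd ℂ) a ≠ 0 := by
    intro h'
    apply h0
    rw [← h, ← sub_mul, h', zero_mul]
  have h2 : (starRingEnd ℂ) (z / (z - a)) =
      1 - -(starRingEnd ℂ) a * z / (1 - (starRingEnd ℂ) a * z) := by
    rw [map_div₀, map_sub]
    field_simp
    linear_combination (-(starRingEnd ℂ) a) * h
  rw [← Complex.conj_re, h2, Complex.sub_re, Complex.one_re]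

theorem re_herglotzRieszKernel_eq {b z : ℂ} (hb : ‖b‖ < 1) (hz : ‖z‖ = 1) :
    (herglotzRieszKernel 0 b z).re =
      1 - 2 * (-(starRingEnd ℂ) b * z / (1 - (starRingEnd ℂ) b * z)).re := by
  have h0 : z - b ≠ 0 := by
    intro h
    rw [sub_eq_zero.1 h] at hz
    linarith
  have : herglotzRieszKernel 0 b z = 2 * (z / (z - b)) - 1 := by
    simp only [herglotzRieszKernel_def, sub_zero]
    field_simp
    ring
  have h2 : (herglotzRieszKernel 0 b z).re = 2 * (z / (z - b)).re - 1 := by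
    rw [this]; simp
  rw [h2, re_div_sub_eq hb hz]
  ring

open InnerProductSpace in
/-- If two functions with logarithmic poles at `a` and `b` in the unit disk have vanishing
Wronskian on the unit circle, then their regular parts agree at the swapped poles. -/
theorem regular_part_symm {a b : ℂ} (ha : ‖a‖ < 1) (hb : ‖b‖ < 1) {u v : ℂ → ℝ} {U : Set ℂ}
    (hU : IsOpen U) (hball : closedBall (0 : ℂ) 1 ⊆ U) (hu : ContDiffOn ℝ 1 u U)
    (hv : ContDiffOn ℝ 1 v U) (hu' : HarmonicOnNhd u (ball 0 1))
    (hv' : HarmonicOnNhd v (ball 0 1)) {c : ℝ} (hc : c ≠ 0)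
    (hW : ∀ z : ℂ, ‖z‖ = 1 →
      (c * Real.log ‖z - a‖ + u z) * fderiv ℝ (fun w => c * Real.log ‖w - b‖ + v w) z z =
      (c * Real.log ‖z - b‖ + v z) * fderiv ℝ (fun w => c * Real.log ‖w - a‖ + u w) z z) :
    u b = v a := by
  let h : ℂ → ℂ → ℝ := fun a z => Real.log ‖1 - (starRingEnd ℂ) a * z‖
  let A : ℂ → ℝ := fun z => c * h a z + u z
  let B : ℂ → ℝ := fun z => c * h b z + v z
  let O : ℂ → Set ℂ := fun a => {z | 1 - (starRingEnd ℂ) a * z ≠ 0}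
  have hO : ∀ a, IsOpen (O a) := fun a => isOpen_ne_fun (by fun_prop) (by fun_prop)
  let U' := U ∩ (O a ∩ O b)
  have hU' : IsOpen U' := hU.inter ((hO a).inter (hO b))
  have hball' : closedBall (0 : ℂ) 1 ⊆ U' := fun z hz =>
    ⟨hball hz, one_sub_conj_mul_ne_zero ha (by simpa using hz),
      one_sub_conj_mul_ne_zero hb (by simpa using hz)⟩
  have hhD : ∀ a, ContDiffOn ℝ 1 (h a) (O a) := fun a => by
    refine ContDiffOn.log (ContDiffOn.norm ℝ (by fun_prop) fun z hz => hz) fun z hz => ?_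
    exact norm_ne_zero_iff.2 hz
  have hhH : ∀ a, ‖a‖ < 1 → HarmonicOnNhd (h a) (ball 0 1) := fun a ha z hz => by
    refine AnalyticAt.harmonicAt_log_norm (f := fun z => 1 - (starRingEnd ℂ) a * z)
      (by fun_prop) (one_sub_conj_mul_ne_zero ha ?_)
    simpa using (mem_ball_zero_iff.1 hz).le
  have hAD : ContDiffOn ℝ 1 A U' :=
    (contDiffOn_const.mul ((hhD a).mono fun z hz => hz.2.1)).add (hu.mono fun z hz => hz.1)
  have hBD : ContDiffOn ℝ 1 B U' :=
    (contDiffOn_const.mul ((hhD b).mono fun z hz => hz.2.2)).add (hv.mono fun z hz => hz.1)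
  have hAH : HarmonicOnNhd A (ball 0 1) := ((hhH a ha).const_smul (c := c)).add hu'
  have hBH : HarmonicOnNhd B (ball 0 1) := ((hhH b hb).const_smul (c := c)).add hv'
  have hgreen := circleAverage_green hU' hball' hAD hBD hAH hBH
  have hpA := (HarmonicContOnCl.mk_ball hAH
    (hAD.continuousOn.mono hball')).circleAverage_re_herglotzRieszKernel_smul (w := b) (by simpa)
  have hpB := (HarmonicContOnCl.mk_ball hBH
    (hBD.continuousOn.mono hball')).circleAverage_re_herglotzRieszKernel_smul (w := a) (by simpa)
  have hder : ∀ a : ℂ, ‖a‖ < 1 → ∀ w : ℂ → ℝ, ∀ z : ℂ, ‖z‖ = 1 → DifferentiableAt ℝ w z →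
      fderiv ℝ (fun y => c * Real.log ‖y - a‖ + w y) z z =
        fderiv ℝ (fun y => c * h a y + w y) z z + c * (herglotzRieszKernel 0 a z).re := by
    intro a ha w z hz hw
    have h0 : z - a ≠ 0 := by
      intro h
      rw [sub_eq_zero.1 h] at hz
      linarith
    obtain ⟨L, hL, hL'⟩ := hasFDerivAt_log_norm ((hasDerivAt_id z).sub_const a) h0
    obtain ⟨M, hM, hM'⟩ := hasFDerivAt_log_norm
      (((hasDerivAt_id z).const_mul ((starRingEnd ℂ) a)).const_sub 1)
      (one_sub_conj_mul_ne_zero ha hz.le)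
    have h1 := ((hL.const_mul c).add hw.hasFDerivAt).fderiv
    have h2 := ((hM.const_mul c).add hw.hasFDerivAt).fderiv
    have h3 := re_div_sub_eq ha hz
    simp only [id, one_mul, mul_one] at hL' hM'
    rw [re_herglotzRieszKernel_eq ha hz]
    erw [h1, h2]
    simp [hL' z, hM' z, h3]
    ring
  have hdu : ∀ z : ℂ, ‖z‖ = 1 → DifferentiableAt ℝ u z ∧ DifferentiableAt ℝ v z := fun z hz => by
    have hz' : U ∈ nhds z := hU.mem_nhds (hball (by simpa using hz.le))
    exact ⟨(hu.contDiffAt hz').differentiableAt one_ne_zero,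
      (hv.contDiffAt hz').differentiableAt one_ne_zero⟩
  have hker : ∀ a : ℂ, ‖a‖ < 1 →
      ContinuousOn (fun z => (herglotzRieszKernel 0 a z).re) (sphere (0 : ℂ) 1) := fun a ha => by
    have : ∀ z ∈ sphere (0 : ℂ) 1, z - a ≠ 0 := by
      intro z hz h
      rw [sub_eq_zero.1 h] at hz
      simp at hz
      linarith
    simp only [herglotzRieszKernel_def, sub_zero]
    exact Complex.continuous_re.comp_continuousOn
      (ContinuousOn.div (by fun_prop) (by fun_prop) this)
  have hsph : sphere (0 : ℂ) 1 ⊆ U' := sphere_subset_closedBall.trans hball'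
  have hAc := hAD.continuousOn.mono hsph
  have hBc := hBD.continuousOn.mono hsph
  have hA1 := ((hAD.continuousOn_fderiv_of_isOpen hU' le_rfl).clm_apply
    continuousOn_id).mono hsph
  have hB1 := ((hBD.continuousOn_fderiv_of_isOpen hU' le_rfl).clm_apply
    continuousOn_id).mono hsph
  have hsum : Real.circleAverage (fun z => (A z * fderiv ℝ B z z - B z * fderiv ℝ A z z) +
      c * ((herglotzRieszKernel 0 b z).re * A z - (herglotzRieszKernel 0 a z).re * B z))
      0 1 = 0 := by
    refine Real.circleAverage_const_on_circle fun z hz => ?_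
    have hz : ‖z‖ = 1 := by simpa using hz
    have key := hW z hz
    rw [hder b hb v z hz (hdu z hz).2, hder a ha u z hz (hdu z hz).1,
      norm_sub_eq_norm_one_sub_conj_mul hz, norm_sub_eq_norm_one_sub_conj_mul hz] at key
    change A z * (fderiv ℝ B z z + _) = B z * (fderiv ℝ A z z + _) at key
    linear_combination key
  have hkA : CircleIntegrable (fun z => (herglotzRieszKernel 0 b z).re * A z) 0 1 :=
    ((hker b hb).mul hAc).circleIntegrable zero_le_one
  have hkB : CircleIntegrable (fun z => (herglotzRieszKernel 0 a z).re * B z) 0 1 :=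
    ((hker a ha).mul hBc).circleIntegrable zero_le_one
  have hwr : CircleIntegrable (fun z => A z * fderiv ℝ B z z - B z * fderiv ℝ A z z) 0 1 :=
    ((hAc.mul hB1).sub (hBc.mul hA1)).circleIntegrable zero_le_one
  have hkAB : CircleIntegrable (fun z => c * ((herglotzRieszKernel 0 b z).re * A z -
      (herglotzRieszKernel 0 a z).re * B z)) 0 1 :=
    (continuousOn_const.mul (((hker b hb).mul hAc).sub
      ((hker a ha).mul hBc))).circleIntegrable zero_le_one
  have hmul : ∀ f : ℂ → ℝ, Real.circleAverage (fun z => c * f z) 0 1 =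
      c * Real.circleAverage f 0 1 := fun f => Real.circleAverage_fun_smul (a := c)
  rw [Real.circleAverage_fun_add hwr hkAB, hgreen, hmul, Real.circleAverage_fun_sub hkA hkB,
    zero_add] at hsum
  erw [hpA, hpB] at hsum
  have hAB : A b = B a := by
    have := (mul_eq_zero.1 hsum).resolve_left hc
    linarith
  have hsymm : h a b = h b a := by
    simp only [h]
    rw [← RCLike.norm_conj]
    simp [mul_comm]
  simp only [A, B, hsymm] at hAB
  linarith

open InnerProductSpace in
theorem IsHarmonicOn.harmonicOnNhd_comp {R : EuclideanSpace ℝ (Fin 2) → ℝ}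
    {s : Set (EuclideanSpace ℝ (Fin 2))} (hs : IsOpen s) (hR : IsHarmonicOn R s) :
    HarmonicOnNhd (R ∘ Complex.orthonormalBasisOneI.repr)
      (Complex.orthonormalBasisOneI.repr ⁻¹' s) := by
  set e := Complex.orthonormalBasisOneI.repr
  have h1 : e 1 = EuclideanSpace.single 0 1 := by
    simpa using Complex.orthonormalBasisOneI.repr_self 0
  have hI : e Complex.I = EuclideanSpace.single 1 1 := by
    simpa using Complex.orthonormalBasisOneI.repr_self 1
  have hs' : IsOpen (e ⁻¹' s) := hs.preimage e.continuous
  have hC : ∀ p ∈ s, ContDiffAt ℝ 2 R p := fun p hp => hR.1.contDiffAt (hs.mem_nhds hp)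
  intro z hz
  refine ⟨(hC _ hz).comp z e.contDiff.contDiffAt, ?_⟩
  filter_upwards [hs'.mem_nhds hz] with w hw
  have hd : DifferentiableAt ℝ (fderiv ℝ R) (e w) :=
    ((hC _ hw).fderiv_right (m := 1) (by norm_num)).differentiableAt one_ne_zero
  have hsnd : ∀ a b, fderiv ℝ (fun x => fderiv ℝ R x a) (e w) b =
      fderiv ℝ (fderiv ℝ R) (e w) b a := fun a b => by
    rw [fderiv_clm_apply hd (by fun_prop)]
    simp
  have hL := hR.2 _ hw
  simp only [laplacian2, Fin.sum_univ_two, hsnd] at hL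
  have hcomp := e.toContinuousLinearEquiv.iteratedFDerivWithin_comp_right R uniqueDiffOn_univ
    (x := w) (Set.mem_univ _) 2
  simp only [Set.preimage_univ, iteratedFDerivWithin_univ] at hcomp
  change iteratedFDeriv ℝ 2 (R ∘ e) w = _ at hcomp
  simp only [laplacian_eq_iteratedFDeriv_complexPlane, hcomp]
  simpa [iteratedFDeriv_two_apply, h1, hI] using hL

/-- Symmetry of the Steklov–Neumann Green's function of the unit disk: if
`S_x = (1/(2π))·log‖x - ·‖ + R_x` and `S_y = (1/(2π))·log‖y - ·‖ + R_y` (with `R_x, R_y`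
harmonic) both satisfy the Steklov–Neumann boundary conditions for the partition
`(Γ_S, S¹ \ Γ_S)` with the same parameter `λ`, then `S_x(y) = S_y(x)`. -/
theorem green_function_symmetric
    (ΓS : Set (EuclideanSpace ℝ (Fin 2)))
    (hΓSm : MeasurableSet ΓS) (hΓS : ΓS ⊆ sphere (0 : EuclideanSpace ℝ (Fin 2)) 1)
    (lam : ℝ) (x y : EuclideanSpace ℝ (Fin 2))
    (hx : x ∈ ball (0 : EuclideanSpace ℝ (Fin 2)) 1)
    (hy : y ∈ ball (0 : EuclideanSpace ℝ (Fin 2)) 1) (hxy : x ≠ y)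
    (Rx Ry : EuclideanSpace ℝ (Fin 2) → ℝ)
    (V : Set (EuclideanSpace ℝ (Fin 2))) (hV : IsOpen V)
    (hVball : closedBall (0 : EuclideanSpace ℝ (Fin 2)) 1 ⊆ V)
    (hRxC1 : ContDiffOn ℝ 1 Rx V) (hRyC1 : ContDiffOn ℝ 1 Ry V)
    (hRxharm : IsHarmonicOn Rx (ball (0 : EuclideanSpace ℝ (Fin 2)) 1))
    (hRyharm : IsHarmonicOn Ry (ball (0 : EuclideanSpace ℝ (Fin 2)) 1))
    (Sx Sy : EuclideanSpace ℝ (Fin 2) → ℝ)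
    (hSx : ∀ z, Sx z = (1 / (2 * Real.pi)) * Real.log ‖x - z‖ + Rx z)
    (hSy : ∀ z, Sy z = (1 / (2 * Real.pi)) * Real.log ‖y - z‖ + Ry z)
    (hSxbcS : ∀ p ∈ ΓS, fderiv ℝ Sx p p = lam * Sx p)
    (hSybcS : ∀ p ∈ ΓS, fderiv ℝ Sy p p = lam * Sy p)
    (hSxbcN : ∀ p ∈ sphere (0 : EuclideanSpace ℝ (Fin 2)) 1 \ ΓS, fderiv ℝ Sx p p = 0)
    (hSybcN : ∀ p ∈ sphere (0 : EuclideanSpace ℝ (Fin 2)) 1 \ ΓS, fderiv ℝ Sy p p = 0) :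
    Sx y = Sy x := by
  set e := Complex.orthonormalBasisOneI.repr
  set c : ℝ := 1 / (2 * Real.pi)
  have hdist : ∀ (p : EuclideanSpace ℝ (Fin 2)) (z : ℂ), ‖p - e z‖ = ‖z - e.symm p‖ := by
    intro p z
    rw [norm_sub_rev, ← e.norm_map (z - e.symm p)]
    simp
  have hball : e ⁻¹' ball 0 1 = ball 0 1 := by
    ext z; simp
  have hcomp : ∀ (S : EuclideanSpace ℝ (Fin 2) → ℝ) (z : ℂ),
      fderiv ℝ (S ∘ e) z z = fderiv ℝ S (e z) (e z) := by
    intro S z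
    have := e.toContinuousLinearEquiv.comp_right_fderiv (f := S) (x := z)
    exact congrArg (fun L => L z) this
  have hSxe : (fun w => c * Real.log ‖w - e.symm x‖ + (Rx ∘ e) w) = Sx ∘ e := by
    ext w; simp [hSx, hdist]
  have hSye : (fun w => c * Real.log ‖w - e.symm y‖ + (Ry ∘ e) w) = Sy ∘ e := by
    ext w; simp [hSy, hdist]
  have key : (Rx ∘ e) (e.symm y) = (Ry ∘ e) (e.symm x) := by
    refine regular_part_symm (U := e ⁻¹' V) (by simpa using hx) (by simpa using hy)
      (hV.preimage e.continuous) (fun z hz => hVball (by simpa using hz))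
      (hRxC1.comp e.contDiff.contDiffOn fun z hz => hz)
      (hRyC1.comp e.contDiff.contDiffOn fun z hz => hz)
      (hball ▸ hRxharm.harmonicOnNhd_comp isOpen_ball)
      (hball ▸ hRyharm.harmonicOnNhd_comp isOpen_ball) (c := c) (by positivity) fun z hz => ?_
    rw [hSxe, hSye, congrFun hSxe z, congrFun hSye z, hcomp, hcomp]
    have hz1 : e z ∈ sphere (0 : EuclideanSpace ℝ (Fin 2)) 1 := by simpa using hz
    simp only [Function.comp_apply]
    by_cases hz2 : e z ∈ ΓS
    · rw [hSxbcS _ hz2, hSybcS _ hz2]; ring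
    · rw [hSxbcN _ ⟨hz1, hz2⟩, hSybcN _ ⟨hz1, hz2⟩]; ring
  simp only [Function.comp_apply, LinearIsometryEquiv.apply_symm_apply] at key
  rw [hSx, hSy, key, norm_sub_rev]
end
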